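/- Let N ≥ 2 and let μ be the uniform probability measure on the unit sphere of ℂ^N. Let ρ_1, ..., ρ_m be positive semidefinite operators on ℂ^N, each with trace 1, with total rank r = Σ_j rank(ρ_j). Then for every ε ∈ (0, 1], μ{ψ : ⟪ψ, ρ_j ψ⟫ < ε for all j = 1, ..., m} ≥ 1 - r·(1 - ε)^(N-1). -/

import Mathlib

open scoped InnerProductSpace ComplexOrder
open MeasureTheory
open scoped ENNReal

theorem lintegral_complex_exp_neg_mul_sq_Ici {a t : ℝ} (ha : 0 < a) (ht : 0 ≤ t) :
    ∫⁻ z : ℂ, {z : ℂ | t ≤ ‖z‖ ^ 2}.indicator (fun z ↦ ENNReal.ofReal (Real.exp (-a * ‖z‖ ^ 2))) z =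
      ENNReal.ofReal (Real.pi / a * Real.exp (-a * t)) := by
  have hradial : ∫⁻ r in Set.Ioi (Real.sqrt t),
      ENNReal.ofReal (r * Real.exp (-a * r ^ 2)) = ENNReal.ofReal (Real.exp (-a * t) / (2 * a)) := by
    have hderiv : ∀ x ∈ Set.Ici (Real.sqrt t),
        HasDerivAt (fun r : ℝ ↦ -Real.exp (-a * r ^ 2) / (2 * a)) (x * Real.exp (-a * x ^ 2)) x := by
      intro x _
      have h := (((hasDerivAt_pow 2 x).const_mul (-a)).exp.neg).div_const (2 * a)
      refine h.congr_deriv ?_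
      push_cast
      field_simp
    have hpos : ∀ x ∈ Set.Ioi (Real.sqrt t), 0 ≤ x * Real.exp (-a * x ^ 2) := fun x hx ↦
      mul_nonneg ((Real.sqrt_nonneg t).trans (le_of_lt hx)) (Real.exp_pos _).le
    have hlim : Filter.Tendsto (fun r : ℝ ↦ -Real.exp (-a * r ^ 2) / (2 * a)) Filter.atTop
        (nhds (-0 / (2 * a))) := by
      refine (Filter.Tendsto.neg ?_).div_const _
      refine Real.tendsto_exp_atBot.comp ?_
      exact (Filter.tendsto_pow_atTop two_ne_zero).const_mul_atTop_of_neg (neg_lt_zero.2 ha)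
    rw [← ofReal_integral_eq_lintegral_ofReal
      (integrableOn_Ioi_deriv_of_nonneg' hderiv hpos hlim)
      ((ae_restrict_iff' measurableSet_Ioi).2 (Filter.Eventually.of_forall hpos)),
      integral_Ioi_of_hasDerivAt_of_nonneg' hderiv hpos hlim, Real.sq_sqrt ht]
    congr 1
    ring
  have hg : Measurable ((Set.Ici (Real.sqrt t)).indicator
      (fun r ↦ ENNReal.ofReal (r * Real.exp (-a * r ^ 2)))) :=
    Measurable.indicator (by fun_prop) measurableSet_Ici
  have hpolar : ∀ p ∈ Set.Ioi (0 : ℝ) ×ˢ Set.Ioo (-Real.pi) Real.pi, ENNReal.ofReal p.1 •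
      {z : ℂ | t ≤ ‖z‖ ^ 2}.indicator (fun z ↦ ENNReal.ofReal (Real.exp (-a * ‖z‖ ^ 2)))
        (Complex.polarCoord.symm p) =
      (Set.Ici (Real.sqrt t)).indicator (fun r ↦ ENNReal.ofReal (r * Real.exp (-a * r ^ 2))) p.1 *
        1 := by
    intro p hp
    have hr : 0 ≤ p.1 := le_of_lt hp.1
    have hiff : t ≤ p.1 ^ 2 ↔ Real.sqrt t ≤ p.1 := (Real.sqrt_le_left hr).symm
    simp only [Set.indicator_apply, Set.mem_ofPred_eq, Complex.norm_polarCoord_symm, sq_abs, hiff,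
      Set.mem_Ici, smul_eq_mul, mul_ite, mul_zero, mul_one, ENNReal.ofReal_mul hr]
  have hset : (Set.Ici (Real.sqrt t) ∩ Set.Ioi 0 : Set ℝ) =ᵐ[volume] Set.Ioi (Real.sqrt t) := by
    have h := Ioi_ae_eq_Ici (μ := (volume : Measure ℝ)) (a := Real.sqrt t)
    have h' := h.symm.inter (Filter.EventuallyEq.refl (ae volume) (Set.Ioi (0 : ℝ)))
    rwa [Set.inter_eq_left.2 (Set.Ioi_subset_Ioi (Real.sqrt_nonneg t))] at h'
  rw [← Complex.lintegral_comp_polarCoord_symm, polarCoord_target,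
    setLIntegral_congr_fun (measurableSet_Ioi.prod measurableSet_Ioo) hpolar,
    Measure.volume_eq_prod, ← Measure.prod_restrict,
    lintegral_prod_mul hg.aemeasurable aemeasurable_const, lintegral_indicator measurableSet_Ici,
    Measure.restrict_restrict measurableSet_Ici, setLIntegral_congr hset, hradial,
    setLIntegral_one, Real.volume_Ioo, ← ENNReal.ofReal_mul (by positivity)]
  congr 1
  field_simp
  ring

theorem lintegral_pi_prod_eq_pow {f : ℂ → ℝ≥0∞} (hf : Measurable f) (n : ℕ) :
    ∫⁻ w : Fin n → ℂ, ∏ i, f (w i) = (∫⁻ z, f z) ^ n := by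
  induction n with
  | zero => simp [volume_pi]
  | succ n ih =>
    rw [← (volume_preserving_piFinSuccAbove (fun _ : Fin (n + 1) ↦ ℂ) 0).symm.lintegral_comp
      (by fun_prop)]
    simp only [Fin.prod_univ_succ]
    rw [Measure.volume_eq_prod]
    have := lintegral_prod_mul (μ := (volume : Measure ℂ)) (ν := (volume : Measure (Fin n → ℂ)))
      (f := f) (g := fun w ↦ ∏ i, f (w i)) hf.aemeasurable
      (Finset.measurable_prod _ fun i _ ↦ hf.comp (measurable_pi_apply i)).aemeasurable
    rw [ih] at this
    rw [pow_succ', ← this]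
    simp [MeasurableEquiv.piFinSuccAbove]

/-- The Gaussian weight of the cone of vectors whose zeroth coordinate carries at least the
fraction `ε` of the squared Euclidean norm. -/
theorem lintegral_gaussian_cone (n : ℕ) {ε : ℝ} (h0 : 0 ≤ ε) (h1 : ε < 1) :
    ∫⁻ y : Fin (n + 1) → ℂ, {y : Fin (n + 1) → ℂ | ε * ∑ i, ‖y i‖ ^ 2 ≤ ‖y 0‖ ^ 2}.indicator
      (fun y ↦ ENNReal.ofReal (Real.exp (-∑ i, ‖y i‖ ^ 2))) y =
      ENNReal.ofReal (Real.pi ^ (n + 1) * (1 - ε) ^ n) := by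
  have h1' : 0 < 1 - ε := sub_pos.2 h1
  have hmeas : Measurable ({y : Fin (n + 1) → ℂ | ε * ∑ i, ‖y i‖ ^ 2 ≤ ‖y 0‖ ^ 2}.indicator
      (fun y ↦ ENNReal.ofReal (Real.exp (-∑ i, ‖y i‖ ^ 2)))) :=
    Measurable.indicator (by fun_prop) (measurableSet_le (by fun_prop) (by fun_prop))
  set e := MeasurableEquiv.piFinSuccAbove (fun _ : Fin (n + 1) ↦ ℂ) 0 with he
  have hmp := (volume_preserving_piFinSuccAbove (fun _ : Fin (n + 1) ↦ ℂ) 0).symm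
  rw [← hmp.lintegral_comp hmeas, Measure.volume_eq_prod,
    lintegral_prod_symm _ (by
      exact (hmeas.comp e.symm.measurable).aemeasurable)]
  have hinner : ∀ w : Fin n → ℂ, ∫⁻ z : ℂ,
      ({y : Fin (n + 1) → ℂ | ε * ∑ i, ‖y i‖ ^ 2 ≤ ‖y 0‖ ^ 2}.indicator
      (fun y ↦ ENNReal.ofReal (Real.exp (-∑ i, ‖y i‖ ^ 2)))) (e.symm (z, w)) =
      ENNReal.ofReal Real.pi * ∏ i, ENNReal.ofReal (Real.exp (-(1 / (1 - ε)) * ‖w i‖ ^ 2)) := by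
    intro w
    set S := ∑ i, ‖w i‖ ^ 2 with hS
    have hS0 : 0 ≤ S := by positivity
    have hpt : ∀ z : ℂ, ({y : Fin (n + 1) → ℂ | ε * ∑ i, ‖y i‖ ^ 2 ≤ ‖y 0‖ ^ 2}.indicator
      (fun y ↦ ENNReal.ofReal (Real.exp (-∑ i, ‖y i‖ ^ 2)))) (e.symm (z, w)) =
        ENNReal.ofReal (Real.exp (-S)) * {z : ℂ | ε / (1 - ε) * S ≤ ‖z‖ ^ 2}.indicator
          (fun z ↦ ENNReal.ofReal (Real.exp (-1 * ‖z‖ ^ 2))) z := by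
      intro z
      have hiff : ε * (‖z‖ ^ 2 + S) ≤ ‖z‖ ^ 2 ↔ ε / (1 - ε) * S ≤ ‖z‖ ^ 2 := by
        rw [div_mul_eq_mul_div, div_le_iff₀ h1']
        constructor <;> intro h <;> linarith
      have hsymm : e.symm (z, w) = Fin.cons z w := by
        simp [he, MeasurableEquiv.piFinSuccAbove, Fin.consEquiv]
      simp only [hsymm, Set.indicator_apply, Set.mem_ofPred_eq, Fin.sum_univ_succ, Fin.cons_zero,
        Fin.cons_succ, ← hS, hiff, mul_ite, mul_zero]
      rw [← ENNReal.ofReal_mul (Real.exp_pos _).le, ← Real.exp_add]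
      congr 3
      ring
    simp_rw [hpt]
    rw [lintegral_const_mul' _ _ ENNReal.ofReal_ne_top,
      lintegral_complex_exp_neg_mul_sq_Ici one_pos (by positivity),
      ← ENNReal.ofReal_prod_of_nonneg (fun _ _ ↦ (Real.exp_pos _).le), ← Real.exp_sum,
      ← Finset.mul_sum, ← hS, ← ENNReal.ofReal_mul (Real.exp_pos _).le,
      ← ENNReal.ofReal_mul Real.pi_pos.le, mul_left_comm, ← Real.exp_add, div_one]
    congr 3
    field_simp
    ring
  rw [lintegral_congr hinner]
  have hone := lintegral_complex_exp_neg_mul_sq_Ici (a := 1 / (1 - ε)) (t := 0) (by positivity)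
    le_rfl
  have huniv : {z : ℂ | (0 : ℝ) ≤ ‖z‖ ^ 2} = Set.univ := Set.eq_univ_of_forall fun z ↦ sq_nonneg ‖z‖
  rw [huniv, Set.indicator_univ] at hone
  rw [lintegral_const_mul' _ _ ENNReal.ofReal_ne_top, lintegral_pi_prod_eq_pow
      (f := fun z ↦ ENNReal.ofReal (Real.exp (-(1 / (1 - ε)) * ‖z‖ ^ 2))) (by fun_prop), hone,
    ← ENNReal.ofReal_pow (by positivity), ← ENNReal.ofReal_mul Real.pi_pos.le]
  congr 1
  rw [div_div_eq_mul_div, div_one, mul_zero, Real.exp_zero, mul_one, mul_pow]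
  ring

theorem measurableSpace_complexEuclidean_eq_borel (N : ℕ) :
    WithLp.measurableSpace 2 (Fin N → ℂ) = borel (EuclideanSpace ℂ (Fin N)) :=
  BorelSpace.measurable_eq (α := EuclideanSpace ℂ (Fin N))

/-- The Lebesgue measure on complex Euclidean space, transported from the product measure. -/
noncomputable def complexEuclideanVolume (N : ℕ) : Measure (EuclideanSpace ℂ (Fin N)) :=
  Measure.map (WithLp.toLp 2) (volume : Measure (Fin N → ℂ))

instance (N : ℕ) : (complexEuclideanVolume N).IsAddHaarMeasure :=
  ((PiLp.continuousLinearEquiv 2 ℂ (fun _ : Fin N ↦ ℂ)).symm).isAddHaarMeasure_map volume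

theorem map_complexEuclideanVolume {N : ℕ}
    (U : EuclideanSpace ℂ (Fin N) ≃ₗᵢ[ℂ] EuclideanSpace ℂ (Fin N)) :
    Measure.map U (complexEuclideanVolume N) = complexEuclideanVolume N := by
  have hHaar : (Measure.map U (complexEuclideanVolume N)).IsAddHaarMeasure :=
    U.toContinuousLinearEquiv.isAddHaarMeasure_map _
  have h := Measure.isAddLeftInvariant_eq_smul (Measure.map U (complexEuclideanVolume N))
    (complexEuclideanVolume N)
  set c := Measure.addHaarScalarFactor (Measure.map U (complexEuclideanVolume N))
    (complexEuclideanVolume N)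
  have hball := congrArg (fun ν : Measure _ ↦ ν (Metric.ball 0 1)) h
  have hpre : U ⁻¹' Metric.ball 0 1 = Metric.ball 0 1 := by
    ext x
    simp
  simp only [Measure.smul_apply] at hball
  rw [Measure.map_apply U.continuous.measurable measurableSet_ball, hpre] at hball
  have hc : (c : ℝ≥0∞) = 1 := by
    have hpos := (Metric.measure_ball_pos (complexEuclideanVolume N) 0 one_pos).ne'
    have hfin := (measure_ball_lt_top (μ := complexEuclideanVolume N) (x := 0) (r := 1)).ne
    refine (ENNReal.mul_left_inj hpos hfin).1 ?_
    rw [one_mul]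
    exact hball.symm
  rw [h, ENNReal.coe_eq_one.1 hc, one_smul]

/-- The unnormalised Gaussian measure on complex Euclidean space. -/
noncomputable def complexEuclideanGaussian (N : ℕ) : Measure (EuclideanSpace ℂ (Fin N)) :=
  (complexEuclideanVolume N).withDensity fun y ↦ ENNReal.ofReal (Real.exp (-‖y‖ ^ 2))

instance (N : ℕ) : SFinite (complexEuclideanGaussian N) := by
  unfold complexEuclideanGaussian
  infer_instance

theorem map_complexEuclideanGaussian {N : ℕ}
    (U : EuclideanSpace ℂ (Fin N) ≃ₗᵢ[ℂ] EuclideanSpace ℂ (Fin N)) :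
    Measure.map U (complexEuclideanGaussian N) = complexEuclideanGaussian N := by
  ext s hs
  have hw : Measurable fun y : EuclideanSpace ℂ (Fin N) ↦
      ENNReal.ofReal (Real.exp (-‖y‖ ^ 2)) := by fun_prop
  have hU : Measurable U := U.continuous.measurable
  rw [Measure.map_apply hU hs, complexEuclideanGaussian, withDensity_apply _ (hU hs),
    withDensity_apply _ hs]
  nth_rewrite 2 [← map_complexEuclideanVolume U]
  rw [setLIntegral_map hs hw hU]
  simp

theorem complexEuclideanGaussian_cone (n : ℕ) {ε : ℝ} (h0 : 0 ≤ ε) (h1 : ε < 1) :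
    complexEuclideanGaussian (n + 1) {y | ε * ‖y‖ ^ 2 ≤ ‖y 0‖ ^ 2} =
      ENNReal.ofReal (Real.pi ^ (n + 1) * (1 - ε) ^ n) := by
  have hs : MeasurableSet {y : EuclideanSpace ℂ (Fin (n + 1)) | ε * ‖y‖ ^ 2 ≤ ‖y 0‖ ^ 2} :=
    measurableSet_le (by fun_prop) (by fun_prop)
  rw [complexEuclideanGaussian, withDensity_apply _ hs, ← lintegral_indicator hs,
    complexEuclideanVolume, lintegral_map (Measurable.indicator (by fun_prop) hs) (by fun_prop),
    ← lintegral_gaussian_cone n h0 h1]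
  simp only [Set.indicator_apply, Set.mem_ofPred_eq, EuclideanSpace.norm_sq_eq]

theorem exists_linearIsometryEquiv_inner_eq_apply_zero {n : ℕ}
    {x : EuclideanSpace ℂ (Fin (n + 1))} (hx : ‖x‖ = 1) :
    ∃ U : EuclideanSpace ℂ (Fin (n + 1)) ≃ₗᵢ[ℂ] EuclideanSpace ℂ (Fin (n + 1)),
      ∀ y, ⟪x, y⟫_ℂ = U y 0 := by
  have horth : Orthonormal ℂ (({0} : Set (Fin (n + 1))).domRestrict fun _ ↦ x) := by
    refine ⟨fun _ ↦ hx, fun i j hij ↦ (hij (Subsingleton.elim i j)).elim⟩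
  obtain ⟨b, hb⟩ := horth.exists_orthonormalBasis_extension_of_card_eq (by simp)
  exact ⟨b.repr, fun y ↦ by rw [b.repr_apply_apply, hb 0 rfl]⟩

theorem measure_setOf_le_norm_inner_sq_eq {n : ℕ} {ν : Measure (EuclideanSpace ℂ (Fin (n + 1)))}
    (hν : ∀ U : EuclideanSpace ℂ (Fin (n + 1)) ≃ₗᵢ[ℂ] EuclideanSpace ℂ (Fin (n + 1)),
      Measure.map U ν = ν)
    {x : EuclideanSpace ℂ (Fin (n + 1))} (hx : ‖x‖ = 1) (ε : ℝ) :
    ν {y | ε * ‖y‖ ^ 2 ≤ ‖⟪x, y⟫_ℂ‖ ^ 2} = ν {y | ε * ‖y‖ ^ 2 ≤ ‖y 0‖ ^ 2} := by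
  obtain ⟨U, hU⟩ := exists_linearIsometryEquiv_inner_eq_apply_zero hx
  conv_rhs => rw [← hν U]
  rw [Measure.map_apply U.continuous.measurable (measurableSet_le (by fun_prop) (by fun_prop))]
  simp [hU]

theorem measure_setOf_le_norm_inner_sq_of_lt_one {n : ℕ}
    {μ : Measure (EuclideanSpace ℂ (Fin (n + 1)))} [IsProbabilityMeasure μ]
    (hsphere : ∀ᵐ x ∂μ, ‖x‖ = 1)
    (hinv : ∀ U : EuclideanSpace ℂ (Fin (n + 1)) ≃ₗᵢ[ℂ] EuclideanSpace ℂ (Fin (n + 1)),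
      Measure.map U μ = μ)
    {e : EuclideanSpace ℂ (Fin (n + 1))} (he : ‖e‖ = 1) {ε : ℝ} (h0 : 0 ≤ ε) (h1 : ε < 1) :
    μ {x | ε * ‖x‖ ^ 2 ≤ ‖⟪e, x⟫_ℂ‖ ^ 2} = ENNReal.ofReal ((1 - ε) ^ n) := by
  set γ := complexEuclideanGaussian (n + 1) with hγ
  set p := μ {x | ε * ‖x‖ ^ 2 ≤ ‖⟪e, x⟫_ℂ‖ ^ 2} with hp
  have htotal : γ Set.univ = ENNReal.ofReal (Real.pi ^ (n + 1)) := by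
    simpa using! complexEuclideanGaussian_cone n le_rfl one_pos
  have hγ0 : ∀ᵐ y ∂γ, y ≠ 0 := by
    have hac : γ ≪ complexEuclideanVolume (n + 1) := withDensity_absolutelyContinuous _ _
    exact hac.ae_le (Measure.ae_ne _ 0)
  let s : Set (EuclideanSpace ℂ (Fin (n + 1)) × EuclideanSpace ℂ (Fin (n + 1))) :=
    {q | ε * (‖q.1‖ ^ 2 * ‖q.2‖ ^ 2) ≤ ‖⟪q.1, q.2⟫_ℂ‖ ^ 2}
  have hs : MeasurableSet s := measurableSet_le (by fun_prop) (by fun_prop)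
  have hleft : μ.prod γ s = ENNReal.ofReal (Real.pi ^ (n + 1) * (1 - ε) ^ n) := by
    rw [Measure.prod_apply hs, ← complexEuclideanGaussian_cone n h0 h1]
    have hfiber : ∀ᵐ x ∂μ, γ (Prod.mk x ⁻¹' s) =
        γ {y | ε * ‖y‖ ^ 2 ≤ ‖y 0‖ ^ 2} := by
      filter_upwards [hsphere] with x hx
      rw [← measure_setOf_le_norm_inner_sq_eq map_complexEuclideanGaussian hx]
      simp [s, hx, hγ]
    rw [lintegral_congr_ae hfiber]
    simp [hγ]
  have hright : μ.prod γ s = p * ENNReal.ofReal (Real.pi ^ (n + 1)) := by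
    rw [Measure.prod_apply_symm hs, ← htotal, ← lintegral_const]
    refine lintegral_congr_ae ?_
    filter_upwards [hγ0] with y hy
    have hy' : ‖y‖ ≠ 0 := norm_ne_zero_iff.2 hy
    have hunit : ‖((‖y‖⁻¹ : ℝ) : ℂ) • y‖ = 1 := by
      simp [norm_smul, hy']
    rw [hp, measure_setOf_le_norm_inner_sq_eq hinv he,
      ← measure_setOf_le_norm_inner_sq_eq hinv hunit]
    congr 1
    ext x
    have hpos : 0 < ‖y‖ ^ 2 := by positivity
    simp only [s, Set.mem_preimage, Set.mem_ofPred_eq, inner_smul_left, norm_mul, mul_pow,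
      norm_inner_symm y x]
    simp
    rw [inv_mul_eq_div, le_div_iff₀ hpos, mul_assoc]
  have hpi : ENNReal.ofReal (Real.pi ^ (n + 1)) ≠ 0 := by
    simpa using by positivity
  refine (ENNReal.mul_left_inj hpi ENNReal.ofReal_ne_top).1 ?_
  rw [← hright, hleft, mul_comm, ENNReal.ofReal_mul]
  positivity

theorem measure_setOf_le_norm_inner_sq_le {n : ℕ}
    {μ : Measure (EuclideanSpace ℂ (Fin (n + 1)))} [IsProbabilityMeasure μ]
    (hsphere : ∀ᵐ x ∂μ, ‖x‖ = 1)
    (hinv : ∀ U : EuclideanSpace ℂ (Fin (n + 1)) ≃ₗᵢ[ℂ] EuclideanSpace ℂ (Fin (n + 1)),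
      Measure.map U μ = μ)
    {e : EuclideanSpace ℂ (Fin (n + 1))} (he : ‖e‖ = 1) {ε : ℝ} (h0 : 0 < ε) (h1 : ε ≤ 1) :
    μ {x | ε * ‖x‖ ^ 2 ≤ ‖⟪e, x⟫_ℂ‖ ^ 2} ≤ ENNReal.ofReal ((1 - ε) ^ n) := by
  have hlim : Filter.Tendsto (fun δ : ℝ ↦ ENNReal.ofReal ((1 - δ) ^ n)) (nhdsWithin ε (Set.Iio ε))
      (nhds (ENNReal.ofReal ((1 - ε) ^ n))) :=
    (Continuous.tendsto (ENNReal.continuous_ofReal.comp (by fun_prop)) ε).mono_left nhdsWithin_le_nhds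
  refine ge_of_tendsto hlim ?_
  filter_upwards [Ioo_mem_nhdsLT h0] with δ hδ
  rw [← measure_setOf_le_norm_inner_sq_of_lt_one hsphere hinv he hδ.1.le (hδ.2.trans_le h1)]
  refine measure_mono fun x hx ↦ ?_
  exact (mul_le_mul_of_nonneg_right hδ.2.le (sq_nonneg ‖x‖)).trans hx

theorem Matrix.IsHermitian.re_inner_toEuclideanLin_self {N : ℕ} {A : Matrix (Fin N) (Fin N) ℂ}
    (hA : A.IsHermitian) (ψ : EuclideanSpace ℂ (Fin N)) :
    (⟪ψ, Matrix.toEuclideanLin A ψ⟫_ℂ).re =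
      ∑ i, hA.eigenvalues i * ‖⟪hA.eigenvectorBasis i, ψ⟫_ℂ‖ ^ 2 := by
  have hsymm := Matrix.isSymmetric_toEuclideanLin_iff.mpr hA
  have heig : ∀ i, Matrix.toEuclideanLin A (hA.eigenvectorBasis i) =
      (hA.eigenvalues i : ℂ) • hA.eigenvectorBasis i := by
    intro i
    ext k
    simpa using! congrFun (hA.mulVec_eigenvectorBasis i) k
  rw [← hA.eigenvectorBasis.sum_inner_mul_inner, Complex.re_sum]
  refine Finset.sum_congr rfl fun i _ ↦ ?_
  rw [← hsymm, heig, inner_smul_left, Complex.conj_ofReal, mul_left_comm,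
    ← inner_conj_symm ψ, Complex.conj_mul', ← Complex.ofReal_pow, ← Complex.ofReal_mul,
    Complex.ofReal_re]

theorem Matrix.PosSemidef.exists_le_norm_inner_eigenvectorBasis_sq {N : ℕ}
    {A : Matrix (Fin N) (Fin N) ℂ} (hA : A.PosSemidef) (htr : A.trace = 1)
    {ψ : EuclideanSpace ℂ (Fin N)} {ε : ℝ}
    (h : ε ≤ (⟪ψ, Matrix.toEuclideanLin A ψ⟫_ℂ).re) :
    ∃ i, hA.isHermitian.eigenvalues i ≠ 0 ∧
      ε ≤ ‖⟪hA.isHermitian.eigenvectorBasis i, ψ⟫_ℂ‖ ^ 2 := by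
  have hsum : ∑ i, hA.isHermitian.eigenvalues i = 1 := by
    have h := hA.isHermitian.trace_eq_sum_eigenvalues
    rw [htr] at h
    apply_fun Complex.re at h
    simpa using h.symm
  by_contra! hlt
  rw [hA.isHermitian.re_inner_toEuclideanLin_self] at h
  refine h.not_gt ?_
  obtain ⟨k, hk⟩ : ∃ k, hA.isHermitian.eigenvalues k ≠ 0 := by
    by_contra! hzero
    simp [hzero] at hsum
  calc _ < ∑ i, hA.isHermitian.eigenvalues i * ε := by
        refine Finset.sum_lt_sum (fun i _ ↦ ?_) ⟨k, Finset.mem_univ k, ?_⟩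
        · by_cases hi : hA.isHermitian.eigenvalues i = 0
          · simp [hi]
          · exact mul_le_mul_of_nonneg_left (hlt i hi).le (hA.eigenvalues_nonneg i)
        · exact mul_lt_mul_of_pos_left (hlt k hk) ((hA.eigenvalues_nonneg k).lt_of_ne' hk)
    _ = ε := by rw [← Finset.sum_mul, hsum, one_mul]

/-- for densities `ρ_1, …, ρ_m` on `ℂ^N` of total rank `r`, a uniformly
random pure state has fidelity less than `ε` with every `ρ_j` with probability at least
`1 - r·(1-ε)^(N-1)`. -/
theorem stmt_5 (N : ℕ) (hN : 2 ≤ N)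
    [MeasurableSpace (EuclideanSpace ℂ (Fin N))] [BorelSpace (EuclideanSpace ℂ (Fin N))]
    (μ : Measure (EuclideanSpace ℂ (Fin N))) [IsProbabilityMeasure μ]
    (hsphere : μ {ψ : EuclideanSpace ℂ (Fin N) | ‖ψ‖ = 1} = 1)
    (hinv : ∀ U : EuclideanSpace ℂ (Fin N) ≃ₗᵢ[ℂ] EuclideanSpace ℂ (Fin N),
      Measure.map U μ = μ)
    (m : ℕ) (ρ : Fin m → Matrix (Fin N) (Fin N) ℂ)
    (hρ : ∀ j, (ρ j).PosSemidef) (hρtr : ∀ j, (ρ j).trace = 1)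
    (r : ℕ) (hr : r = ∑ j, (ρ j).rank)
    (ε : ℝ) (hε : ε ∈ Set.Ioc (0 : ℝ) 1) :
    ENNReal.ofReal (1 - r * (1 - ε) ^ (N - 1)) ≤
      μ {ψ : EuclideanSpace ℂ (Fin N) |
        ∀ j, (⟪ψ, Matrix.toEuclideanLin (ρ j) ψ⟫_ℂ).re < ε} := by
  obtain ⟨n, rfl⟩ : ∃ n, N = n + 1 := ⟨N - 1, by omega⟩
  obtain rfl : ‹MeasurableSpace (EuclideanSpace ℂ (Fin (n + 1)))› =
      WithLp.measurableSpace 2 (Fin (n + 1) → ℂ) :=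
    (BorelSpace.measurable_eq (α := EuclideanSpace ℂ (Fin (n + 1)))).trans
      (measurableSpace_complexEuclidean_eq_borel (n + 1)).symm
  have hmeas : MeasurableSet {ψ : EuclideanSpace ℂ (Fin (n + 1)) | ‖ψ‖ = 1} :=
    measurableSet_eq_fun (by fun_prop) measurable_const
  have hae : ∀ᵐ ψ ∂μ, ‖ψ‖ = 1 := (mem_ae_iff_prob_eq_one hmeas).2 hsphere
  set G := {ψ : EuclideanSpace ℂ (Fin (n + 1)) |
    ∀ j, (⟪ψ, Matrix.toEuclideanLin (ρ j) ψ⟫_ℂ).re < ε}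
  have hcompl : μ Gᶜ ≤ ENNReal.ofReal (r * (1 - ε) ^ n) := by
    have hsub : Gᶜ ≤ᵐ[μ] ⋃ j, ⋃ i : {i // (hρ j).isHermitian.eigenvalues i ≠ 0},
        {ψ | ε * ‖ψ‖ ^ 2 ≤ ‖⟪(hρ j).isHermitian.eigenvectorBasis i, ψ⟫_ℂ‖ ^ 2} := by
      filter_upwards [hae] with ψ hψ hmem
      obtain ⟨j, hj⟩ : ∃ j, ε ≤ (⟪ψ, Matrix.toEuclideanLin (ρ j) ψ⟫_ℂ).re := by
        by_contra! h
        exact hmem h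
      obtain ⟨i, hi, hle⟩ := (hρ j).exists_le_norm_inner_eigenvectorBasis_sq (hρtr j) hj
      refine Set.mem_iUnion₂.2 ⟨j, ⟨i, hi⟩, ?_⟩
      simpa [hψ] using hle
    calc μ Gᶜ ≤ _ := measure_mono_ae hsub
      _ ≤ ∑ j, ∑ _i : {i // (hρ j).isHermitian.eigenvalues i ≠ 0},
          ENNReal.ofReal ((1 - ε) ^ n) := by
        refine (measure_iUnion_fintype_le μ _).trans (Finset.sum_le_sum fun j _ ↦ ?_)
        refine (measure_iUnion_fintype_le μ _).trans (Finset.sum_le_sum fun i _ ↦ ?_)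
        exact measure_setOf_le_norm_inner_sq_le hae hinv
          ((hρ j).isHermitian.eigenvectorBasis.orthonormal.1 i) hε.1 hε.2
      _ = ENNReal.ofReal (r * (1 - ε) ^ n) := by
        simp only [Finset.sum_const, Finset.card_univ, nsmul_eq_mul,
          ← (hρ _).isHermitian.rank_eq_card_non_zero_eigs]
        rw [← Finset.sum_mul, ENNReal.ofReal_mul (Nat.cast_nonneg r), ENNReal.ofReal_natCast, hr,
          Nat.cast_sum]
  have hone : 1 ≤ μ G + μ Gᶜ := by
    rw [← measure_univ (μ := μ), ← Set.union_compl_self G]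
    exact measure_union_le _ _
  rw [Nat.add_sub_cancel, ENNReal.ofReal_sub _ (by have := hε.2; bound), ENNReal.ofReal_one]
  exact tsub_le_iff_right.2 (hone.trans (by gcongr))
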